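/- Let b₀, …, bₙ : ℝ → Matrix (Fin r) (Fin r) ℝ be smooth, and let P : ℝ → Matrix (Fin r) (Fin m) ℝ and Q : ℝ → Matrix (Fin m) (Fin r) ℝ be smooth with support bounded below. Let 𝕋 = Σ_{i=0}^{n} M_{b_i}∘D^i + M_P∘I∘M_Q acting on W_r. For p ∈ ℕ and smooth F : ℝ → Matrix (Fin r) (Fin p) ℝ with support bounded below define 𝕃·F := Σ_{i=0}^{n} b_i·F^{(i)} + P·I(Q·F), and for smooth G : ℝ → Matrix (Fin p) (Fin r) ℝ with support bounded below define 𝕃*·G := Σ_{i=0}^{n} (-1)^i (G·b_i)^{(i)} - I(G·P)·Q. Then for every k ≥ 1 there exist N ∈ ℕ and smooth c₀, …, c_N : ℝ → Matrix (Fin r) (Fin r) ℝ such that, as operators on W_r, 𝕋^k = Σ_{i=0}^{N} M_{c_i}∘D^i + Σ_{j=0}^{k-1} M_{𝕃^{k-1-j}·P}∘I∘M_{(𝕃*)^j·Q}. (This is the lemma (𝕃^k)₋ = Σ_{j=0}^{k-1} 𝕃^{k-j-1}(P^{(r)}) ∂⁻¹ (𝕃*)^j(Q^{(r)}) for the constrained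 multi-component KP Lax operator.) -/

import Mathlib

open MeasureTheory Finset

/-- A function `ℝ → A` has support bounded below. -/
def SuppBddBelowR {A : Type*} [Zero A] (f : ℝ → A) : Prop :=
  ∃ a : ℝ, ∀ x : ℝ, x ≤ a → f x = 0

/-- The integration operator applied componentwise to vector-valued functions. -/
noncomputable def IopV {p : ℕ} (f : ℝ → Fin p → ℝ) : ℝ → Fin p → ℝ :=
  fun x => ∫ y in Set.Iic x, f y

/-- The integration operator applied entrywise to matrix-valued functions. -/
noncomputable def matInt {p q : ℕ} (a : ℝ → Matrix (Fin p) (Fin q) ℝ) :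
    ℝ → Matrix (Fin p) (Fin q) ℝ :=
  fun x => Matrix.of fun i j => ∫ y in Set.Iic x, a y i j

/-- The `k`-th derivative applied entrywise to matrix-valued functions. -/
noncomputable def matIter {p q : ℕ} (k : ℕ) (a : ℝ → Matrix (Fin p) (Fin q) ℝ) :
    ℝ → Matrix (Fin p) (Fin q) ℝ :=
  fun x => Matrix.of fun i j => iteratedDeriv k (fun y => a y i j) x

/-- A matrix-valued function is smooth (entrywise `C^∞`). -/
def MatSmooth {p q : ℕ} (a : ℝ → Matrix (Fin p) (Fin q) ℝ) : Prop :=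
  ∀ (i : Fin p) (j : Fin q), ContDiff ℝ (⊤ : ℕ∞) fun x => a x i j

/-- The operator `𝕋 = Σ_{i=0}^{n} M_{b_i}∘Dⁱ + M_P∘I∘M_Q` acting on `W_r`. -/
noncomputable def TTop {r m : ℕ} (n : ℕ) (b : ℕ → ℝ → Matrix (Fin r) (Fin r) ℝ)
    (P : ℝ → Matrix (Fin r) (Fin m) ℝ) (Q : ℝ → Matrix (Fin m) (Fin r) ℝ)
    (g : ℝ → Fin r → ℝ) : ℝ → Fin r → ℝ :=
  fun x => (∑ i ∈ Finset.range (n + 1), (b i x).mulVec (iteratedDeriv i g x))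
    + (P x).mulVec (IopV (fun y => (Q y).mulVec (g y)) x)

/-- The action `𝕃·F = Σ_{i=0}^{n} b_i·F⁽ⁱ⁾ + P·I(Q·F)` on matrix-valued functions. -/
noncomputable def LLMat {r m p : ℕ} (n : ℕ) (b : ℕ → ℝ → Matrix (Fin r) (Fin r) ℝ)
    (P : ℝ → Matrix (Fin r) (Fin m) ℝ) (Q : ℝ → Matrix (Fin m) (Fin r) ℝ)
    (F : ℝ → Matrix (Fin r) (Fin p) ℝ) : ℝ → Matrix (Fin r) (Fin p) ℝ :=
  fun x => (∑ i ∈ Finset.range (n + 1), b i x * matIter i F x)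
    + P x * matInt (fun y => Q y * F y) x

/-- The adjoint action `𝕃*·G = Σ_{i=0}^{n} (-1)ⁱ(G·b_i)⁽ⁱ⁾ - I(G·P)·Q`. -/
noncomputable def LLStarMat {r m p : ℕ} (n : ℕ) (b : ℕ → ℝ → Matrix (Fin r) (Fin r) ℝ)
    (P : ℝ → Matrix (Fin r) (Fin m) ℝ) (Q : ℝ → Matrix (Fin m) (Fin r) ℝ)
    (G : ℝ → Matrix (Fin p) (Fin r) ℝ) : ℝ → Matrix (Fin p) (Fin r) ℝ :=
  fun x => (∑ i ∈ Finset.range (n + 1),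
      ((-1 : ℝ) ^ i) • matIter i (fun y => G y * b i y) x)
    - matInt (fun y => G y * P y) x * Q x

section SupportBddBelow

variable {A B C : Type*} [Zero A] [Zero B] [Zero C]

theorem SuppBddBelowR.of_imp {f : ℝ → A} {u : ℝ → B} (hf : SuppBddBelowR f)
    (h : ∀ x, f x = 0 → u x = 0) : SuppBddBelowR u :=
  hf.imp fun _ ha x hx => h x (ha x hx)

theorem SuppBddBelowR.of_imp₂ {f : ℝ → A} {g : ℝ → B} {u : ℝ → C} (hf : SuppBddBelowR f)
    (hg : SuppBddBelowR g) (h : ∀ x, f x = 0 → g x = 0 → u x = 0) : SuppBddBelowR u := by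
  obtain ⟨a, ha⟩ := hf
  obtain ⟨b, hb⟩ := hg
  exact ⟨min a b, fun x hx =>
    h x (ha x (hx.trans (min_le_left _ _))) (hb x (hx.trans (min_le_right _ _)))⟩

end SupportBddBelow

theorem SuppBddBelowR.finset_sum {A ι : Type*} [AddCommMonoid A] {s : Finset ι}
    {f : ι → ℝ → A} (h : ∀ i ∈ s, SuppBddBelowR (f i)) :
    SuppBddBelowR fun x => ∑ i ∈ s, f i x := by
  classical
  induction s using Finset.induction_on with
  | empty => exact ⟨0, fun x _ => by simp⟩
  | insert i s hi ih =>
    refine (h i (Finset.mem_insert_self i s)).of_imp₂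
      (ih fun j hj => h j (Finset.mem_insert_of_mem hj)) fun x h1 h2 => ?_
    rw [Finset.sum_insert hi, h1, h2, add_zero]

section Primitive

variable {E : Type*} [NormedAddCommGroup E] [NormedSpace ℝ E]

theorem SuppBddBelowR.deriv {f : ℝ → E} (hf : SuppBddBelowR f) : SuppBddBelowR (deriv f) := by
  obtain ⟨a, ha⟩ := hf
  refine ⟨a - 1, fun x hx => ?_⟩
  have h : f =ᶠ[nhds x] fun _ => 0 := by
    filter_upwards [Iio_mem_nhds (show x < a by linarith)] with y hy
    exact ha y (le_of_lt hy)
  rw [h.deriv_eq, deriv_const]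

theorem SuppBddBelowR.iteratedDeriv {f : ℝ → E} (hf : SuppBddBelowR f) (i : ℕ) :
    SuppBddBelowR (iteratedDeriv i f) := by
  induction i with
  | zero => simpa using hf
  | succ i ih => rw [iteratedDeriv_succ]; exact ih.deriv

theorem SuppBddBelowR.integral {f : ℝ → E} (hf : SuppBddBelowR f) :
    SuppBddBelowR fun x => ∫ y in Set.Iic x, f y := by
  obtain ⟨a, ha⟩ := hf
  exact ⟨a, fun x hx => setIntegral_eq_zero_of_forall_eq_zero fun y hy => ha y (le_trans hy hx)⟩

theorem SuppBddBelowR.integrableOn_Iic {F : Type*} [NormedAddCommGroup F] {f : ℝ → F} (hf : SuppBddBelowR f)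
    (hc : Continuous f) (x : ℝ) : IntegrableOn f (Set.Iic x) := by
  obtain ⟨a, ha⟩ := hf
  have h1 : IntegrableOn f (Set.Iic a) :=
    integrableOn_zero.congr_fun (fun y hy => (ha y hy).symm) measurableSet_Iic
  refine (h1.union (hc.integrableOn_Icc (a := a) (b := x))).mono_set fun y hy => ?_
  rcases le_total y a with h | h
  · exact Or.inl h
  · exact Or.inr ⟨h, hy⟩

theorem ContDiff.iteratedDeriv_infty {f : ℝ → E} (hf : ContDiff ℝ (⊤ : ℕ∞) f) (i : ℕ) :
    ContDiff ℝ (⊤ : ℕ∞) (iteratedDeriv i f) := by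
  rw [iteratedDeriv_eq_iterate]
  exact hf.iterate_deriv i

theorem ContDiff.hasDerivAt_infty {f : ℝ → E} (hf : ContDiff ℝ (⊤ : ℕ∞) f) (x : ℝ) :
    HasDerivAt f (deriv f x) x :=
  ((contDiff_infty_iff_deriv.mp hf).1 x).hasDerivAt

variable [CompleteSpace E]

theorem SuppBddBelowR.hasDerivAt_integral {f : ℝ → E} (hf : SuppBddBelowR f)
    (hc : Continuous f) (x : ℝ) :
    HasDerivAt (fun x => ∫ y in Set.Iic x, f y) (f x) x := by
  have h : (fun x => ∫ y in Set.Iic x, f y)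
      = fun x => (∫ y in Set.Iic 0, f y) + ∫ y in (0 : ℝ)..x, f y := by
    funext z
    rw [← intervalIntegral.integral_Iic_sub_Iic (hf.integrableOn_Iic hc 0)
      (hf.integrableOn_Iic hc z), add_sub_cancel]
  rw [h]
  exact (hc.integral_hasStrictDerivAt 0 x).hasDerivAt.const_add _

theorem SuppBddBelowR.contDiff_integral {f : ℝ → E} (hf : SuppBddBelowR f)
    (hs : ContDiff ℝ (⊤ : ℕ∞) f) :
    ContDiff ℝ (⊤ : ℕ∞) fun x => ∫ y in Set.Iic x, f y := by
  have h := hf.hasDerivAt_integral hs.continuous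
  refine contDiff_infty_iff_deriv.mpr ⟨fun x => (h x).differentiableAt, ?_⟩
  rw [show _root_.deriv (fun x => ∫ y in Set.Iic x, f y) = f from funext fun x => (h x).deriv]
  exact hs

/-- A primitive with support bounded below is the integral from `-∞`. -/
theorem SuppBddBelowR.eq_integral {u f : ℝ → E} (hu : SuppBddBelowR u) (hf : SuppBddBelowR f)
    (hc : Continuous f) (h : ∀ x, HasDerivAt u (f x) x) (x : ℝ) :
    u x = ∫ y in Set.Iic x, f y := by
  have hd : ∀ x, HasDerivAt (fun x => u x - ∫ y in Set.Iic x, f y) 0 x := fun x => by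
    simpa using (h x).fun_sub (hf.hasDerivAt_integral hc x)
  obtain ⟨a, ha⟩ := hu.of_imp₂ (u := fun x => u x - ∫ y in Set.Iic x, f y) hf.integral
    fun x h1 h2 => by rw [h1, h2, sub_zero]
  have := is_const_of_deriv_eq_zero (fun x => (hd x).differentiableAt)
    (fun x => (hd x).deriv) x a
  exact sub_eq_zero.mp (this.trans (ha a le_rfl))

end Primitive

theorem iteratedDeriv_pi_apply {ι : Type*} [Fintype ι] {f : ℝ → ι → ℝ}
    (hf : ContDiff ℝ (⊤ : ℕ∞) f) (i : ℕ) (x : ℝ) (j : ι) :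
    iteratedDeriv i f x j = iteratedDeriv i (fun y => f y j) x := by
  induction i generalizing x with
  | zero => simp
  | succ i ih =>
    rw [iteratedDeriv_succ, iteratedDeriv_succ,
      ← (hasDerivAt_pi.mp ((hf.iteratedDeriv_infty i).hasDerivAt_infty x) j).deriv]
    exact congrArg (fun u => deriv u x) (funext ih)

/-- Smooth vector-valued functions with support bounded below. -/
def IsTestVec {p : ℕ} (g : ℝ → Fin p → ℝ) : Prop :=
  ContDiff ℝ (⊤ : ℕ∞) g ∧ SuppBddBelowR g

/-- Smooth matrix-valued functions with support bounded below. -/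
def IsTestMat {p q : ℕ} (a : ℝ → Matrix (Fin p) (Fin q) ℝ) : Prop :=
  MatSmooth a ∧ SuppBddBelowR a

section MatrixCalculus

variable {p q s : ℕ}

theorem MatSmooth.zero : MatSmooth (fun _ => (0 : Matrix (Fin p) (Fin q) ℝ)) :=
  fun _ _ => contDiff_const

theorem MatSmooth.add {a b : ℝ → Matrix (Fin p) (Fin q) ℝ} (ha : MatSmooth a)
    (hb : MatSmooth b) : MatSmooth fun x => a x + b x :=
  fun i j => (ha i j).add (hb i j)

theorem MatSmooth.sub {a b : ℝ → Matrix (Fin p) (Fin q) ℝ} (ha : MatSmooth a)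
    (hb : MatSmooth b) : MatSmooth fun x => a x - b x :=
  fun i j => (ha i j).sub (hb i j)

theorem MatSmooth.const_smul {a : ℝ → Matrix (Fin p) (Fin q) ℝ} (ha : MatSmooth a) (c : ℝ) :
    MatSmooth fun x => c • a x :=
  fun i j => (ha i j).const_smul c

theorem MatSmooth.sum {ι : Type*} {t : Finset ι} {a : ι → ℝ → Matrix (Fin p) (Fin q) ℝ}
    (ha : ∀ i ∈ t, MatSmooth (a i)) : MatSmooth fun x => ∑ i ∈ t, a i x := by
  intro i j
  simp only [Matrix.sum_apply]
  exact ContDiff.sum fun k hk => ha k hk i j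

theorem MatSmooth.mul {a : ℝ → Matrix (Fin p) (Fin q) ℝ} {b : ℝ → Matrix (Fin q) (Fin s) ℝ}
    (ha : MatSmooth a) (hb : MatSmooth b) : MatSmooth fun x => a x * b x := by
  intro i j
  simp only [Matrix.mul_apply]
  exact ContDiff.sum fun k _ => (ha i k).mul (hb k j)

theorem MatSmooth.mulVec {a : ℝ → Matrix (Fin p) (Fin q) ℝ} {g : ℝ → Fin q → ℝ}
    (ha : MatSmooth a) (hg : ContDiff ℝ (⊤ : ℕ∞) g) :
    ContDiff ℝ (⊤ : ℕ∞) fun x => (a x).mulVec (g x) := by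
  refine contDiff_pi.mpr fun i => ?_
  simp only [Matrix.mulVec, dotProduct]
  exact ContDiff.sum fun k _ => (ha i k).mul (contDiff_pi.mp hg k)

theorem MatSmooth.iter {a : ℝ → Matrix (Fin p) (Fin q) ℝ} (ha : MatSmooth a) (k : ℕ) :
    MatSmooth (matIter k a) :=
  fun i j => (ha i j).iteratedDeriv_infty k

theorem SuppBddBelowR.apply {a : ℝ → Matrix (Fin p) (Fin q) ℝ} (ha : SuppBddBelowR a)
    (i : Fin p) (j : Fin q) : SuppBddBelowR fun x => a x i j :=
  ha.of_imp fun x hx => by rw [hx]; rfl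

theorem SuppBddBelowR.of_apply {a : ℝ → Matrix (Fin p) (Fin q) ℝ}
    (ha : ∀ i j, SuppBddBelowR fun x => a x i j) : SuppBddBelowR a := by
  have h := SuppBddBelowR.finset_sum (s := Finset.univ)
    (f := fun (ij : Fin p × Fin q) x => |a x ij.1 ij.2|)
    fun ij _ => (ha ij.1 ij.2).of_imp fun x hx => by rw [hx, abs_zero]
  refine h.of_imp fun x hx => ?_
  ext i j
  have := (Finset.sum_eq_zero_iff_of_nonneg fun (ij : Fin p × Fin q) _ =>
    abs_nonneg (a x ij.1 ij.2)).mp hx (i, j) (Finset.mem_univ _)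
  simpa using this

theorem SuppBddBelowR.iter {a : ℝ → Matrix (Fin p) (Fin q) ℝ} (ha : SuppBddBelowR a)
    (k : ℕ) : SuppBddBelowR (matIter k a) :=
  .of_apply fun i j => (ha.apply i j).iteratedDeriv k

theorem matIter_zero (a : ℝ → Matrix (Fin p) (Fin q) ℝ) : matIter 0 a = a := by
  funext x
  ext i j
  simp [matIter]

theorem matIter_one_matIter (a : ℝ → Matrix (Fin p) (Fin q) ℝ) (k : ℕ) :
    matIter 1 (matIter k a) = matIter (k + 1) a := by
  funext x
  ext i j
  simp only [matIter, Matrix.of_apply, iteratedDeriv_succ, iteratedDeriv_zero]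

theorem matIter_matIter_one (a : ℝ → Matrix (Fin p) (Fin q) ℝ) (k : ℕ) :
    matIter k (matIter 1 a) = matIter (k + 1) a := by
  funext x
  ext i j
  simp only [matIter, Matrix.of_apply, iteratedDeriv_succ', iteratedDeriv_zero]

theorem MatSmooth.hasDerivAt {a : ℝ → Matrix (Fin p) (Fin q) ℝ} (ha : MatSmooth a)
    (x : ℝ) (i : Fin p) (j : Fin q) :
    HasDerivAt (fun y => a y i j) (matIter 1 a x i j) x := by
  simpa [matIter, iteratedDeriv_one] using (ha i j).hasDerivAt_infty x

theorem HasDerivAt.matrix_mulVec {a : ℝ → Matrix (Fin p) (Fin q) ℝ}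
    {a' : Matrix (Fin p) (Fin q) ℝ} {g : ℝ → Fin q → ℝ} {g' : Fin q → ℝ} {x : ℝ}
    (ha : ∀ i j, HasDerivAt (fun y => a y i j) (a' i j) x) (hg : HasDerivAt g g' x) :
    HasDerivAt (fun y => (a y).mulVec (g y)) (a'.mulVec (g x) + (a x).mulVec g') x := by
  refine hasDerivAt_pi.mpr fun i => ?_
  simp only [Matrix.mulVec, dotProduct, Pi.add_apply, ← Finset.sum_add_distrib]
  exact HasDerivAt.fun_sum fun k _ => (ha i k).mul (hasDerivAt_pi.mp hg k)

theorem MatSmooth.hasDerivAt_mulVec {a : ℝ → Matrix (Fin p) (Fin q) ℝ} {g : ℝ → Fin q → ℝ}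
    {g' : Fin q → ℝ} {x : ℝ} (ha : MatSmooth a) (hg : HasDerivAt g g' x) :
    HasDerivAt (fun y => (a y).mulVec (g y))
      ((matIter 1 a x).mulVec (g x) + (a x).mulVec g') x :=
  .matrix_mulVec (ha.hasDerivAt x) hg

namespace IsTestVec

variable {g h : ℝ → Fin p → ℝ}

theorem add (hg : IsTestVec g) (hh : IsTestVec h) : IsTestVec fun x => g x + h x :=
  ⟨hg.1.add hh.1, hg.2.of_imp₂ hh.2 fun x h1 h2 => by rw [h1, h2, add_zero]⟩

theorem sum {ι : Type*} {t : Finset ι} {f : ι → ℝ → Fin p → ℝ}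
    (hf : ∀ i ∈ t, IsTestVec (f i)) : IsTestVec fun x => ∑ i ∈ t, f i x :=
  ⟨ContDiff.sum fun i hi => (hf i hi).1, .finset_sum fun i hi => (hf i hi).2⟩

theorem mulVec {a : ℝ → Matrix (Fin q) (Fin p) ℝ} (ha : MatSmooth a) (hg : IsTestVec g) :
    IsTestVec fun x => (a x).mulVec (g x) :=
  ⟨ha.mulVec hg.1, hg.2.of_imp fun x hx => by rw [hx, Matrix.mulVec_zero]⟩

theorem iteratedDeriv (hg : IsTestVec g) (i : ℕ) : IsTestVec (iteratedDeriv i g) :=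
  ⟨hg.1.iteratedDeriv_infty i, hg.2.iteratedDeriv i⟩

theorem integral (hg : IsTestVec g) : IsTestVec (IopV g) :=
  ⟨hg.2.contDiff_integral hg.1, hg.2.integral⟩

theorem hasDerivAt (hg : IsTestVec g) (x : ℝ) : HasDerivAt g (deriv g x) x :=
  hg.1.hasDerivAt_infty x

theorem hasDerivAt_IopV (hg : IsTestVec g) (x : ℝ) : HasDerivAt (IopV g) (g x) x :=
  hg.2.hasDerivAt_integral hg.1.continuous x

theorem eq_IopV {u : ℝ → Fin p → ℝ} (hu : IsTestVec u) (hg : IsTestVec g)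
    (h : ∀ x, HasDerivAt u (g x) x) (x : ℝ) : u x = IopV g x :=
  hu.2.eq_integral hg.2 hg.1.continuous h x

theorem IopV_apply (hg : IsTestVec g) (x : ℝ) (j : Fin p) :
    IopV g x j = ∫ y in Set.Iic x, g y j :=
  SuppBddBelowR.eq_integral (u := fun x => IopV g x j) (f := fun y => g y j)
    (hg.integral.2.of_imp fun x hx => by rw [hx]; rfl)
    (hg.2.of_imp fun x hx => by rw [hx]; rfl)
    (contDiff_pi.mp hg.1 j).continuous
    (fun x => hasDerivAt_pi.mp (hg.hasDerivAt_IopV x) j) x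

end IsTestVec

namespace IsTestMat

variable {a b : ℝ → Matrix (Fin p) (Fin q) ℝ}

theorem add (ha : IsTestMat a) (hb : IsTestMat b) : IsTestMat fun x => a x + b x :=
  ⟨ha.1.add hb.1, ha.2.of_imp₂ hb.2 fun x h1 h2 => by rw [h1, h2, add_zero]⟩

theorem sub (ha : IsTestMat a) (hb : IsTestMat b) : IsTestMat fun x => a x - b x :=
  ⟨ha.1.sub hb.1, ha.2.of_imp₂ hb.2 fun x h1 h2 => by rw [h1, h2, sub_zero]⟩

theorem sum {ι : Type*} {t : Finset ι} {f : ι → ℝ → Matrix (Fin p) (Fin q) ℝ}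
    (hf : ∀ i ∈ t, IsTestMat (f i)) : IsTestMat fun x => ∑ i ∈ t, f i x :=
  ⟨MatSmooth.sum fun i hi => (hf i hi).1, .finset_sum fun i hi => (hf i hi).2⟩

theorem const_smul (ha : IsTestMat a) (c : ℝ) : IsTestMat fun x => c • a x :=
  ⟨ha.1.const_smul c, ha.2.of_imp fun x hx => by rw [hx, smul_zero]⟩

theorem mul_left {c : ℝ → Matrix (Fin s) (Fin p) ℝ} (hc : MatSmooth c) (ha : IsTestMat a) :
    IsTestMat fun x => c x * a x :=
  ⟨hc.mul ha.1, ha.2.of_imp fun x hx => by rw [hx, Matrix.mul_zero]⟩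

theorem mul_right {c : ℝ → Matrix (Fin q) (Fin s) ℝ} (ha : IsTestMat a) (hc : MatSmooth c) :
    IsTestMat fun x => a x * c x :=
  ⟨ha.1.mul hc, ha.2.of_imp fun x hx => by rw [hx, Matrix.zero_mul]⟩

theorem iter (ha : IsTestMat a) (k : ℕ) : IsTestMat (matIter k a) :=
  ⟨ha.1.iter k, ha.2.iter k⟩

theorem integral (ha : IsTestMat a) : IsTestMat (matInt a) :=
  ⟨fun i j => (ha.2.apply i j).contDiff_integral (ha.1 i j),
    .of_apply fun i j => (ha.2.apply i j).integral⟩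

theorem hasDerivAt_matInt (ha : IsTestMat a) (x : ℝ) (i : Fin p) (j : Fin q) :
    HasDerivAt (fun y => matInt a y i j) (a x i j) x :=
  (ha.2.apply i j).hasDerivAt_integral (ha.1 i j).continuous x

theorem col (ha : IsTestMat a) (l : Fin q) : IsTestVec fun x i => a x i l :=
  ⟨contDiff_pi.mpr fun i => ha.1 i l, ha.2.of_imp fun x hx => by rw [hx]; rfl⟩

end IsTestMat

end MatrixCalculus

/-- Operators acting on smooth functions with support bounded below as
`∑ i ≤ N, M_{c i} ∘ D ^ i` with smooth coefficients. -/
def IsLocalOp {q p : ℕ} (A : (ℝ → Fin q → ℝ) → ℝ → Fin p → ℝ) : Prop :=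
  ∃ (N : ℕ) (c : ℕ → ℝ → Matrix (Fin p) (Fin q) ℝ), (∀ i, MatSmooth (c i)) ∧
    ∀ g, IsTestVec g → ∀ x, A g x
      = ∑ i ∈ Finset.range (N + 1), (c i x).mulVec (iteratedDeriv i g x)

namespace IsLocalOp

variable {q p s : ℕ} {A B : (ℝ → Fin q → ℝ) → ℝ → Fin p → ℝ}

theorem congr (hA : IsLocalOp A) (h : ∀ g, IsTestVec g → ∀ x, B g x = A g x) : IsLocalOp B := by
  obtain ⟨N, c, hc, hA⟩ := hA
  exact ⟨N, c, hc, fun g hg x => (h g hg x).trans (hA g hg x)⟩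

theorem add (hA : IsLocalOp A) (hB : IsLocalOp B) : IsLocalOp fun g x => A g x + B g x := by
  obtain ⟨N, c, hc, hA⟩ := hA
  obtain ⟨M, d, hd, hB⟩ := hB
  refine ⟨max N M, fun i x => (if i < N + 1 then c i x else 0) + if i < M + 1 then d i x else 0,
    fun i => ?_, fun g hg x => ?_⟩
  · dsimp only
    split_ifs
    · exact (hc i).add (hd i)
    · exact (hc i).add .zero
    · exact MatSmooth.zero.add (hd i)
    · exact MatSmooth.zero.add .zero
  · have extend : ∀ (K : ℕ) (e : ℕ → ℝ → Matrix (Fin p) (Fin q) ℝ), K ≤ max N M →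
        ∑ i ∈ Finset.range (max N M + 1),
          (if i < K + 1 then e i x else 0).mulVec (iteratedDeriv i g x)
        = ∑ i ∈ Finset.range (K + 1), (e i x).mulVec (iteratedDeriv i g x) := by
      intro K e hK
      rw [← Finset.sum_subset (Finset.range_subset_range.mpr (Nat.succ_le_succ hK))]
      · exact Finset.sum_congr rfl fun i hi => by rw [if_pos (Finset.mem_range.mp hi)]
      · intro i _ hi
        rw [if_neg (by simpa using hi), Matrix.zero_mulVec]
    simp only [Matrix.add_mulVec, Finset.sum_add_distrib]
    rw [extend N c (le_max_left _ _), extend M d (le_max_right _ _), hA g hg, hB g hg]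

theorem zero : IsLocalOp fun (_ : ℝ → Fin q → ℝ) (_ : ℝ) => (0 : Fin p → ℝ) :=
  ⟨0, fun _ _ => 0, fun _ => .zero, fun g _ x => by simp⟩

theorem sum {ι : Type*} {t : Finset ι} {A : ι → (ℝ → Fin q → ℝ) → ℝ → Fin p → ℝ}
    (hA : ∀ i ∈ t, IsLocalOp (A i)) : IsLocalOp fun g x => ∑ i ∈ t, A i g x := by
  classical
  induction t using Finset.induction_on with
  | empty => simpa using zero
  | insert i t hi ih =>
    exact ((hA i (Finset.mem_insert_self i t)).add
      (ih fun j hj => hA j (Finset.mem_insert_of_mem hj))).congr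
      fun g _ x => Finset.sum_insert hi

theorem mulVec_iteratedDeriv {c : ℝ → Matrix (Fin p) (Fin q) ℝ} (hc : MatSmooth c) (i : ℕ) :
    IsLocalOp fun g x => (c x).mulVec (iteratedDeriv i g x) := by
  refine ⟨i, fun j x => if j = i then c x else 0, fun j => ?_, fun g _ x => ?_⟩
  · dsimp only
    split_ifs
    · exact hc
    · exact .zero
  · rw [Finset.sum_eq_single i]
    · simp
    · intro j _ hj
      simp [hj]
    · simp

theorem mulVec_self {c : ℝ → Matrix (Fin p) (Fin q) ℝ} (hc : MatSmooth c) :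
    IsLocalOp fun g x => (c x).mulVec (g x) :=
  (mulVec_iteratedDeriv hc 0).congr fun g _ x => by rw [iteratedDeriv_zero]

theorem mulVec {F : ℝ → Matrix (Fin s) (Fin p) ℝ} (hF : MatSmooth F) (hA : IsLocalOp A) :
    IsLocalOp fun g x => (F x).mulVec (A g x) := by
  obtain ⟨N, c, hc, hA⟩ := hA
  refine ⟨N, fun i x => F x * c i x, fun i => hF.mul (hc i), fun g hg x => ?_⟩
  dsimp only
  rw [hA g hg, Matrix.mulVec_sum]
  simp only [Matrix.mulVec_mulVec]

theorem isTestVec (hA : IsLocalOp A) {g : ℝ → Fin q → ℝ} (hg : IsTestVec g) :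
    IsTestVec (A g) := by
  obtain ⟨N, c, hc, hA⟩ := hA
  rw [funext (hA g hg)]
  exact .sum fun i _ => .mulVec (hc i) (hg.iteratedDeriv i)

theorem deriv (hA : IsLocalOp A) : IsLocalOp fun g => deriv (A g) := by
  obtain ⟨N, c, hc, hA⟩ := hA
  refine (sum (t := Finset.range (N + 1)) fun i _ =>
    (mulVec_iteratedDeriv ((hc i).iter 1) i).add (mulVec_iteratedDeriv (hc i) (i + 1))).congr
    fun g hg x => ?_
  rw [funext (hA g hg)]
  refine (HasDerivAt.fun_sum fun i _ => ?_).deriv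
  rw [iteratedDeriv_succ]
  exact (hc i).hasDerivAt_mulVec ((hg.iteratedDeriv i).hasDerivAt x)

theorem iteratedDeriv (hA : IsLocalOp A) (i : ℕ) : IsLocalOp fun g => iteratedDeriv i (A g) := by
  induction i with
  | zero => exact hA.congr fun g _ x => by rw [iteratedDeriv_zero]
  | succ i ih => exact ih.deriv.congr fun g _ x => by rw [iteratedDeriv_succ]

end IsLocalOp

/-- Repeated integration by parts, in differential form. -/
theorem exists_localOp_mulVec_iteratedDeriv {p q : ℕ} (i : ℕ) :
    ∀ H : ℝ → Matrix (Fin p) (Fin q) ℝ, MatSmooth H →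
      ∃ E : (ℝ → Fin q → ℝ) → ℝ → Fin p → ℝ, IsLocalOp E ∧ ∀ g, IsTestVec g → ∀ x,
        (H x).mulVec (iteratedDeriv i g x)
          = deriv (E g) x + (((-1 : ℝ) ^ i) • matIter i H x).mulVec (g x) := by
  induction i with
  | zero =>
    intro H _
    refine ⟨_, .zero, fun g _ x => ?_⟩
    simp [matIter_zero]
  | succ i ih =>
    intro H hH
    obtain ⟨E, hE, h⟩ := ih _ ((hH.iter 1).const_smul (-1))
    refine ⟨_, (IsLocalOp.mulVec_iteratedDeriv hH i).add hE, fun g hg x => ?_⟩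
    have h1 := hH.hasDerivAt_mulVec ((hg.iteratedDeriv i).hasDerivAt x)
    rw [(h1.fun_add ((hE.isTestVec hg).hasDerivAt x)).deriv, iteratedDeriv_succ]
    have h2 := h g hg x
    have h3 : matIter i (fun x => (-1 : ℝ) • matIter 1 H x) x = (-1 : ℝ) • matIter (i + 1) H x := by
      rw [← matIter_matIter_one]
      ext k l
      simp [matIter, iteratedDeriv_succ']
    rw [h3, smul_smul, ← pow_succ, Matrix.smul_mulVec, neg_one_smul] at h2
    rw [add_comm (Matrix.mulVec _ _), add_assoc, add_assoc, ← h2]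
    abel

section PseudoDifferential

variable {r m n p : ℕ} {b : ℕ → ℝ → Matrix (Fin r) (Fin r) ℝ}
  {P : ℝ → Matrix (Fin r) (Fin m) ℝ} {Q : ℝ → Matrix (Fin m) (Fin r) ℝ}

theorem isLocalOp_sum_mulVec (hb : ∀ i, MatSmooth (b i)) :
    IsLocalOp fun g x => ∑ i ∈ Finset.range (n + 1), (b i x).mulVec (iteratedDeriv i g x) :=
  ⟨n, b, hb, fun _ _ _ => rfl⟩

theorem IsTestVec.TTop (hb : ∀ i, MatSmooth (b i)) (hP : MatSmooth P) (hQ : MatSmooth Q)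
    {g : ℝ → Fin r → ℝ} (hg : IsTestVec g) : IsTestVec (TTop n b P Q g) :=
  ((isLocalOp_sum_mulVec hb).isTestVec hg).add (.mulVec hP (IsTestVec.mulVec hQ hg).integral)

theorem IsTestMat.LLMat (hb : ∀ i, MatSmooth (b i)) (hP : MatSmooth P) (hQ : MatSmooth Q)
    {F : ℝ → Matrix (Fin r) (Fin p) ℝ} (hF : IsTestMat F) : IsTestMat (LLMat n b P Q F) :=
  (IsTestMat.sum fun i _ => .mul_left (hb i) (hF.iter i)).add
    (.mul_left hP (IsTestMat.mul_left hQ hF).integral)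

theorem IsTestMat.LLStarMat (hb : ∀ i, MatSmooth (b i)) (hP : MatSmooth P) (hQ : MatSmooth Q)
    {G : ℝ → Matrix (Fin p) (Fin r) ℝ} (hG : IsTestMat G) : IsTestMat (LLStarMat n b P Q G) :=
  (IsTestMat.sum fun i _ => ((hG.mul_right (hb i)).iter i).const_smul _).sub
    ((hG.mul_right hP).integral.mul_right hQ)

theorem IsTestMat.iterate_LLMat (hb : ∀ i, MatSmooth (b i)) (hP : MatSmooth P)
    (hQ : MatSmooth Q) {F : ℝ → Matrix (Fin r) (Fin p) ℝ} (hF : IsTestMat F) (k : ℕ) :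
    IsTestMat ((_root_.LLMat n b P Q)^[k] F) := by
  induction k with
  | zero => exact hF
  | succ k ih => rw [Function.iterate_succ_apply']; exact ih.LLMat hb hP hQ

theorem IsTestMat.iterate_LLStarMat (hb : ∀ i, MatSmooth (b i)) (hP : MatSmooth P)
    (hQ : MatSmooth Q) {G : ℝ → Matrix (Fin p) (Fin r) ℝ} (hG : IsTestMat G) (k : ℕ) :
    IsTestMat ((_root_.LLStarMat n b P Q)^[k] G) := by
  induction k with
  | zero => exact hG
  | succ k ih => rw [Function.iterate_succ_apply']; exact ih.LLStarMat hb hP hQ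

theorem IsTestMat.IopV_mulVec_col {q s : ℕ} {F : ℝ → Matrix (Fin q) (Fin s) ℝ}
    {R : ℝ → Matrix (Fin p) (Fin q) ℝ} (hR : MatSmooth R) (hF : IsTestMat F) (l : Fin s)
    (x : ℝ) : IopV (fun y => (R y).mulVec fun i => F y i l) x
      = fun i => matInt (fun y => R y * F y) x i l := by
  funext j
  rw [(IsTestVec.mulVec hR (hF.col l)).IopV_apply x j]
  rfl

theorem IsTestMat.iteratedDeriv_col {q s : ℕ} {F : ℝ → Matrix (Fin q) (Fin s) ℝ}
    (hF : IsTestMat F) (l : Fin s) (i : ℕ) (x : ℝ) :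
    iteratedDeriv i (fun y j => F y j l) x = fun j => matIter i F x j l :=
  funext fun j => iteratedDeriv_pi_apply (hF.col l).1 i x j

/-- `𝕃·F` is obtained by applying `𝕋` to each column of `F`. -/
theorem TTop_col (hQ : MatSmooth Q) {F : ℝ → Matrix (Fin r) (Fin p) ℝ} (hF : IsTestMat F)
    (l : Fin p) :
    TTop n b P Q (fun x i => F x i l) = fun x i => LLMat n b P Q F x i l := by
  funext x j
  simp only [TTop, LLMat, hF.iteratedDeriv_col, hF.IopV_mulVec_col hQ, Pi.add_apply,
    Finset.sum_apply, Matrix.add_apply, Matrix.sum_apply]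
  rfl

theorem iterate_TTop_col (hb : ∀ i, MatSmooth (b i)) (hP : MatSmooth P) (hQ : MatSmooth Q)
    {F : ℝ → Matrix (Fin r) (Fin p) ℝ} (hF : IsTestMat F) (l : Fin p) (k : ℕ) :
    (TTop n b P Q)^[k] (fun x i => F x i l) = fun x i => (LLMat n b P Q)^[k] F x i l := by
  induction k with
  | zero => rfl
  | succ k ih =>
    rw [Function.iterate_succ_apply', Function.iterate_succ_apply', ih,
      TTop_col hQ (hF.iterate_LLMat hb hP hQ k)]

theorem exists_localOp_IopV_mulVec_TTop (hb : ∀ i, MatSmooth (b i)) (hP : MatSmooth P)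
    (hQ : MatSmooth Q) {G : ℝ → Matrix (Fin p) (Fin r) ℝ} (hG : IsTestMat G) :
    ∃ E : (ℝ → Fin r → ℝ) → ℝ → Fin p → ℝ, IsLocalOp E ∧ ∀ g, IsTestVec g → ∀ x,
      IopV (fun y => (G y).mulVec (TTop n b P Q g y)) x
        = E g x + IopV (fun y => (LLStarMat n b P Q G y).mulVec (g y)) x
          + (matInt (fun y => G y * P y) x).mulVec (IopV (fun y => (Q y).mulVec (g y)) x) := by
  choose E hE h using fun i => exists_localOp_mulVec_iteratedDeriv i
    (fun x => G x * b i x) (hG.1.mul (hb i))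
  refine ⟨_, .sum (t := Finset.range (n + 1)) fun i _ => hE i, fun g hg x => Eq.symm ?_⟩
  have hI := (IsTestVec.mulVec hQ hg).integral
  have hS := IsTestVec.mulVec (hG.LLStarMat (n := n) hb hP hQ).1 hg
  have hGP := (hG.mul_right hP).integral
  refine IsTestVec.eq_IopV
    (u := fun x => (∑ i ∈ Finset.range (n + 1), E i g x)
      + IopV (fun y => (LLStarMat n b P Q G y).mulVec (g y)) x
      + (matInt (fun y => G y * P y) x).mulVec (IopV (fun y => (Q y).mulVec (g y)) x))
    (((IsTestVec.sum fun i _ => (hE i).isTestVec hg).add hS.integral).add (.mulVec hGP.1 hI))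
    (.mulVec hG.1 (hg.TTop hb hP hQ)) (fun x => ?_) x
  have hd := ((HasDerivAt.fun_sum (u := Finset.range (n + 1)) fun i _ =>
    ((hE i).isTestVec hg).hasDerivAt x).fun_add (hS.hasDerivAt_IopV x)).fun_add
    (HasDerivAt.matrix_mulVec ((hG.mul_right hP).hasDerivAt_matInt x)
      ((IsTestVec.mulVec hQ hg).hasDerivAt_IopV x))
  refine hd.congr_deriv ?_
  have h1 : (G x).mulVec (TTop n b P Q g x)
      = ∑ i ∈ Finset.range (n + 1), (G x * b i x).mulVec (iteratedDeriv i g x)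
        + (G x * P x).mulVec (IopV (fun y => (Q y).mulVec (g y)) x) := by
    simp only [TTop, Matrix.mulVec_add, Matrix.mulVec_sum, Matrix.mulVec_mulVec]
  rw [h1, Finset.sum_congr rfl fun i _ => h i g hg x]
  simp only [LLStarMat, Matrix.sub_mulVec, Matrix.sum_mulVec, Finset.sum_add_distrib,
    Matrix.mulVec_mulVec]
  abel

theorem exists_localOp_iteratedDeriv_TTop (hb : ∀ i, MatSmooth (b i)) (hP : MatSmooth P)
    (hQ : MatSmooth Q) (i : ℕ) :
    ∃ E : (ℝ → Fin r → ℝ) → ℝ → Fin r → ℝ, IsLocalOp E ∧ ∀ g, IsTestVec g → ∀ x,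
      iteratedDeriv i (TTop n b P Q g) x
        = E g x + (matIter i P x).mulVec (IopV (fun y => (Q y).mulVec (g y)) x) := by
  induction i with
  | zero =>
    refine ⟨_, isLocalOp_sum_mulVec (n := n) hb, fun g _ x => ?_⟩
    rw [iteratedDeriv_zero, matIter_zero]
    rfl
  | succ i ih =>
    obtain ⟨E, hE, h⟩ := ih
    refine ⟨_, hE.deriv.add (.mulVec_self ((hP.iter i).mul hQ)), fun g hg x => ?_⟩
    have hd := ((hE.isTestVec hg).hasDerivAt x).fun_add
      ((hP.iter i).hasDerivAt_mulVec ((IsTestVec.mulVec hQ hg).hasDerivAt_IopV x))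
    rw [iteratedDeriv_succ, funext (h g hg), hd.deriv, matIter_one_matIter, Matrix.mulVec_mulVec]
    abel

/-- The formula for the `k`-th power of `𝕋`. -/
theorem isLocalOp_iterate_TTop (hb : ∀ i, MatSmooth (b i)) (hP : IsTestMat P)
    (hQ : IsTestMat Q) (k : ℕ) :
    ∃ C : (ℝ → Fin r → ℝ) → ℝ → Fin r → ℝ, IsLocalOp C ∧ ∀ g, IsTestVec g → ∀ x,
      (TTop n b P Q)^[k] g x = C g x + ∑ j ∈ Finset.range k,
        ((LLMat n b P Q)^[k - 1 - j] P x).mulVec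
          (IopV (fun y => ((LLStarMat n b P Q)^[j] Q y).mulVec (g y)) x) := by
  induction k with
  | zero =>
    refine ⟨fun g => g, ?_, fun g _ x => by simp⟩
    exact (IsLocalOp.mulVec_self (c := fun _ => 1) fun i j => contDiff_const).congr
      fun g _ x => by rw [Matrix.one_mulVec]
  | succ k ih =>
    obtain ⟨C, ⟨N, c, hc, hC⟩, h⟩ := ih
    have hF := fun j => hP.iterate_LLMat (n := n) hb hP.1 hQ.1 j
    have hG := fun j => hQ.iterate_LLStarMat (n := n) hb hP.1 hQ.1 j
    choose E hE hEeq using fun j =>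
      exists_localOp_IopV_mulVec_TTop (n := n) hb hP.1 hQ.1 (hG j)
    choose B hB hBeq using fun i => exists_localOp_iteratedDeriv_TTop (n := n) hb hP.1 hQ.1 i
    have hLP : ∀ x, (LLMat n b P Q)^[k] P x
        = ∑ i ∈ Finset.range (N + 1), c i x * matIter i P x
          + ∑ j ∈ Finset.range k, (LLMat n b P Q)^[k - 1 - j] P x
            * matInt (fun y => (LLStarMat n b P Q)^[j] Q y * P y) x := by
      intro x
      ext i l
      have h1 := congrFun (h _ (hP.col l) x) i
      rw [iterate_TTop_col hb hP.1 hQ.1 hP, hC _ (hP.col l)] at h1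
      simp only [hP.iteratedDeriv_col, hP.IopV_mulVec_col (hG _).1, Pi.add_apply,
        Finset.sum_apply] at h1
      rw [h1, Matrix.add_apply, Matrix.sum_apply, Matrix.sum_apply]
      rfl
    refine ⟨_, (IsLocalOp.sum (t := Finset.range (N + 1)) fun i _ => .mulVec (hc i) (hB i)).add
      (.sum (t := Finset.range k) fun j _ => .mulVec (hF (k - 1 - j)).1 (hE j)),
      fun g hg x => ?_⟩
    have hT := hg.TTop (n := n) hb hP.1 hQ.1
    rw [Function.iterate_succ_apply, h _ hT, hC _ hT, Finset.sum_range_succ' _ k]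
    simp only [hBeq _ g hg, hEeq _ g hg, Matrix.mulVec_add, Finset.sum_add_distrib,
      Matrix.mulVec_mulVec, Function.iterate_zero, id_eq, Nat.add_sub_cancel, Nat.sub_zero,
      Function.iterate_succ_apply', hLP, Matrix.add_mulVec, Matrix.sum_mulVec,
      Nat.sub_add_eq, Nat.sub_right_comm k _ 1]
    abel

end PseudoDifferential

/-- for every `k ≥ 1` there exist `N` and smooth `c₀,…,c_N` such that,
as operators on `W_r`,
`𝕋ᵏ = Σ_{i=0}^{N} M_{c_i}∘Dⁱ + Σ_{j=0}^{k-1} M_{𝕃^{k-1-j}·P}∘I∘M_{(𝕃*)ʲ·Q}`. -/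
theorem stmt16 {r m n : ℕ} (b : ℕ → ℝ → Matrix (Fin r) (Fin r) ℝ)
    (P : ℝ → Matrix (Fin r) (Fin m) ℝ) (Q : ℝ → Matrix (Fin m) (Fin r) ℝ)
    (hb : ∀ i, MatSmooth (b i)) (hP : MatSmooth P) (hQ : MatSmooth Q)
    (hPsupp : SuppBddBelowR P) (hQsupp : SuppBddBelowR Q) :
    ∀ k : ℕ, 1 ≤ k →
      ∃ (N : ℕ) (c : ℕ → ℝ → Matrix (Fin r) (Fin r) ℝ),
        (∀ i, MatSmooth (c i)) ∧
        ∀ g : ℝ → Fin r → ℝ, ContDiff ℝ (⊤ : ℕ∞) g → SuppBddBelowR g → ∀ x : ℝ,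
          (TTop n b P Q)^[k] g x
            = (∑ i ∈ Finset.range (N + 1), (c i x).mulVec (iteratedDeriv i g x))
              + ∑ j ∈ Finset.range k,
                  ((LLMat n b P Q)^[k - 1 - j] P x).mulVec
                    (IopV (fun y => ((LLStarMat n b P Q)^[j] Q y).mulVec (g y)) x) := by
  intro k _
  obtain ⟨C, ⟨N, c, hc, hC⟩, h⟩ :=
    isLocalOp_iterate_TTop (n := n) hb ⟨hP, hPsupp⟩ ⟨hQ, hQsupp⟩ k
  exact ⟨N, c, hc, fun g hg hs x => by rw [h g ⟨hg, hs⟩ x, hC g ⟨hg, hs⟩ x]⟩
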